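/- Let d ≥ 2 be an integer and let τ₁, …, τ_d ∈ (0,1) with τ₁ + ⋯ + τ_d > 1. If f₁, …, f_d are pairwise commuting orientation-preserving circle diffeomorphisms such that f_k is of class C^{1+τ_k} (i.e., Df_k is τ_k-Hölder continuous) for each k ∈ {1,…,d}, and the rotation numbers of f₁, …, f_d are independent over the rationals, then f₁, …, f_d are simultaneously topologically conjugate to rigid rotations. -/

import Mathlib

open Filter Set

/-- A modulus of continuity: a continuous, strictly increasing function on `[0,1]`
with value `0` at `0` (hence nonnegative). -/
def IsModulus (ω : ℝ → ℝ) : Prop :=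
  ContinuousOn ω (Icc 0 1) ∧ StrictMonoOn ω (Icc 0 1) ∧ ω 0 = 0 ∧
    ∀ t ∈ Icc (0 : ℝ) 1, 0 ≤ ω t

/-- A concave modulus of continuity. -/
def IsConcaveModulus (ω : ℝ → ℝ) : Prop :=
  IsModulus ω ∧ ConcaveOn ℝ (Icc 0 1) ω

/-- `f` (viewed as data on the circle `ℝ/ℤ`, represented by a function on `ℝ`)
is `ω`-continuous: `sup |f x - f y| / ω |x - y| < ∞`. -/
def OmegaCont (ω f : ℝ → ℝ) : Prop :=
  ∃ K : ℝ, ∀ x y : ℝ, |x - y| ≤ 1 → |f x - f y| ≤ K * ω |x - y|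

/-- `f : ℝ → ℝ` is the lift of an orientation-preserving `C¹` circle diffeomorphism. -/
def IsCircleDiffeoLift (f : ℝ → ℝ) : Prop :=
  StrictMono f ∧ (∀ x, f (x + 1) = f x + 1) ∧ ContDiff ℝ 1 f ∧ ∀ x, 0 < deriv f x

/-- `α` is the rotation number of the circle map with lift `f`. -/
def HasRotationNumber (f : ℝ → ℝ) (α : ℝ) : Prop :=
  Tendsto (fun n : ℕ => f^[n] 0 / n) atTop (nhds α)

/-- `1, α 0, …, α (d-1)` are linearly independent over `ℚ`, i.e. the classes of the
`α k` in `ℝ/ℤ` are independent over the rationals. -/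
def RatIndep {d : ℕ} (α : Fin d → ℝ) : Prop :=
  ∀ (q : Fin d → ℚ) (q₀ : ℚ), (q₀ : ℝ) + ∑ k, (q k : ℝ) * α k = 0 →
    q₀ = 0 ∧ ∀ k, q k = 0

/-- Lift of an (orientation-preserving) circle homeomorphism. -/
def IsCircleHomeoLift (h : ℝ → ℝ) : Prop :=
  Continuous h ∧ StrictMono h ∧ ∀ x, h (x + 1) = h x + 1

/-- The circle maps with lifts `f k` are simultaneously topologically conjugate to
rigid rotations: a single circle homeomorphism conjugates each `f k` to a rotation. -/
def SimultaneouslyConjToRotations {d : ℕ} (f : Fin d → ℝ → ℝ) : Prop :=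
  ∃ h : ℝ → ℝ, IsCircleHomeoLift h ∧ ∀ k, ∃ β : ℝ, ∀ x, h (f k x) = h x + β

theorem sum_piFinset_eq_sum_update {ι M : Type*} [Fintype ι] [DecidableEq ι] [AddCommMonoid M]
    (s : ι → Finset ℕ) (k : ι) (u : Finset ℕ) (g : (ι → ℕ) → M) :
    ∑ p ∈ Fintype.piFinset (Function.update s k u), g p =
      ∑ q ∈ Fintype.piFinset (Function.update s k {0}), ∑ t ∈ u, g (Function.update q k t) := by
  rw [← Finset.sum_product']
  refine Finset.sum_bij' (fun p _ => (Function.update p k 0, p k))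
    (fun x _ => Function.update x.1 k x.2) ?_ ?_ ?_ ?_ ?_
  · intro p hp
    simp only [Fintype.mem_piFinset, Finset.mem_product] at hp ⊢
    refine ⟨fun j => ?_, by simpa using hp k⟩
    by_cases hj : j = k
    · subst hj; simp
    · simpa [hj] using hp j
  · rintro ⟨q, t⟩ hx
    simp only [Fintype.mem_piFinset, Finset.mem_product] at hx ⊢
    intro j
    by_cases hj : j = k
    · subst hj; simpa using hx.2
    · simpa [hj] using hx.1 j
  · intro p _; simp
  · rintro ⟨q, t⟩ hx
    simp only [Fintype.mem_piFinset, Finset.mem_product] at hx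
    have := hx.1 k
    simp only [Function.update_self, Finset.mem_singleton] at this
    simp [← this]
  · intro p _; simp

/-- `PathCost ℓ τ p c` says that a monotone lattice path joins `0` to `p` with total cost `c`,
a step in the direction `k` from the point `q` having cost `ℓ q ^ τ k`. -/
inductive PathCost {ι : Type*} [DecidableEq ι] (ℓ : (ι → ℕ) → ℝ) (τ : ι → ℝ) :
    (ι → ℕ) → ℝ → Prop
  | zero : PathCost ℓ τ 0 0
  | step {p : ι → ℕ} {c : ℝ} (k : ι) (h : PathCost ℓ τ p c) :
      PathCost ℓ τ (p + Pi.single k 1) (c + ℓ p ^ τ k)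

theorem PathCost.extend {ι : Type*} [DecidableEq ι] {ℓ : (ι → ℕ) → ℝ} {τ : ι → ℝ}
    {q : ι → ℕ} {k : ι} {t : ℕ} {c : ℝ} (h : PathCost ℓ τ (Function.update q k t) c)
    (v : ℕ) (hv : t ≤ v) :
    PathCost ℓ τ (Function.update q k v)
      (c + ∑ u ∈ Finset.Ico t v, ℓ (Function.update q k u) ^ τ k) := by
  induction v, hv using Nat.le_induction with
  | base => simpa using h
  | succ v hv ih =>
    rw [Finset.sum_Ico_succ_top hv, ← add_assoc]
    convert ih.step k using 1
    ext j
    by_cases hj : j = k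
    · subst hj; simp
    · simp [hj]

theorem rpow_le_rpow_add_rpow_mul {x l t : ℝ} (hx : 0 ≤ x) (hl : 0 < l) (ht : 0 ≤ t)
    (ht1 : t ≤ 1) : x ^ t ≤ l ^ t + l ^ (t - 1) * x := by
  rcases le_or_gt x l with h | h
  · have := Real.rpow_le_rpow hx h ht
    have : 0 ≤ l ^ (t - 1) * x := by positivity
    linarith
  · have hx' : 0 < x := hl.trans h
    have h1 : x ^ t = x ^ (t - 1) * x := by
      rw [Real.rpow_sub_one hx'.ne']; field_simp
    have h2 : x ^ (t - 1) ≤ l ^ (t - 1) :=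
      Real.rpow_le_rpow_of_nonpos hl h.le (by linarith)
    have h3 : 0 ≤ l ^ t := by positivity
    rw [h1]
    nlinarith

/-- The dyadic box with side lengths `2 ^ n j`. -/
def dyadicBox {ι : Type*} [Fintype ι] [DecidableEq ι] (n : ι → ℕ) : Finset (ι → ℕ) :=
  Fintype.piFinset fun j => Finset.Ico (2 ^ n j - 1) (2 ^ (n j + 1) - 1)

theorem card_dyadic_Ico (m : ℕ) : (Finset.Ico (2 ^ m - 1) (2 ^ (m + 1) - 1)).card = 2 ^ m := by
  have := Nat.one_le_two_pow (n := m)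
  simp only [Nat.card_Ico, pow_succ]; omega

theorem card_dyadicBox {ι : Type*} [Fintype ι] [DecidableEq ι] (n : ι → ℕ) :
    (dyadicBox n).card = 2 ^ ∑ j, n j := by
  rw [dyadicBox, Fintype.card_piFinset, ← Finset.prod_pow_eq_pow_sum]
  exact Finset.prod_congr rfl fun j _ => card_dyadic_Ico _

theorem exists_pathCost_dyadicBox_succ {ι : Type*} [Fintype ι] [DecidableEq ι]
    {ℓ : (ι → ℕ) → ℝ} {τ : ι → ℝ} (hℓ : ∀ p, 0 ≤ ℓ p) (hsum : Summable ℓ)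
    (n : ι → ℕ) (k : ι) (hτ : 0 ≤ τ k) (hτ1 : τ k ≤ 1)
    (F : (ι → ℕ) → ℝ) (hF : ∀ p ∈ dyadicBox n, ∃ c ≤ F p, PathCost ℓ τ p c) :
    ∃ F' : (ι → ℕ) → ℝ,
      (∀ p ∈ dyadicBox (n + Pi.single k 1), ∃ c ≤ F' p, PathCost ℓ τ p c) ∧
      ∑ p ∈ dyadicBox (n + Pi.single k 1), F' p ≤ 2 * ∑ p ∈ dyadicBox n, F p +
        2 ^ (n k + 1) * ((3 + ∑' p, ℓ p) * (2 ^ (∑ j, n j) : ℝ) ^ (1 - τ k)) := by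
  set s : ι → Finset ℕ := fun j => Finset.Ico (2 ^ n j - 1) (2 ^ (n j + 1) - 1) with hs
  set I : Finset ℕ := s k with hI
  set I' : Finset ℕ := Finset.Ico (2 ^ (n k + 1) - 1) (2 ^ (n k + 2) - 1) with hI'
  set W : Finset ℕ := Finset.Ico (2 ^ n k - 1) (2 ^ (n k + 2) - 1) with hW
  set T := Fintype.piFinset (Function.update s k {0}) with hT
  have hpos := Nat.one_le_two_pow (n := n k)
  have hcI : I.card = 2 ^ n k := card_dyadic_Ico _
  have hcI' : I'.card = 2 ^ (n k + 1) := card_dyadic_Ico _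
  have hcW : W.card = 3 * 2 ^ n k := by
    simp only [hW, Nat.card_Ico, pow_succ]; omega
  have hB : dyadicBox n = Fintype.piFinset (Function.update s k I) := by
    rw [hI, Function.update_eq_self, dyadicBox]
  have hB' : dyadicBox (n + Pi.single k 1) = Fintype.piFinset (Function.update s k I') := by
    rw [dyadicBox]
    congr 1
    ext1 j
    by_cases hj : j = k
    · subst hj; simp [hI', add_assoc]
    · simp [hj, hs]
  have hcT : T.card * 2 ^ n k = 2 ^ ∑ j, n j := by
    rw [← card_dyadicBox, hB, Finset.card_eq_sum_ones (Fintype.piFinset (Function.update s k I)),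
      sum_piFinset_eq_sum_update s k I, ← hT]
    simp only [Finset.sum_const, hcI, smul_eq_mul, mul_one]
  set A : (ι → ℕ) → ℝ := fun q => ∑ t ∈ I, F (Function.update q k t) with hA
  set D : (ι → ℕ) → ℝ := fun q => ∑ t ∈ W, ℓ (Function.update q k t) ^ τ k with hD
  refine ⟨fun p => A p / 2 ^ n k + D p, fun p hp => ?_, ?_⟩
  · have hp' : ∀ j, p j ∈ Function.update s k I' j := by
      rw [hB', Fintype.mem_piFinset] at hp; exact hp
    have hne : I.Nonempty := Finset.card_pos.1 (by rw [hcI]; positivity)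
    obtain ⟨t, ht, hFt⟩ : ∃ t ∈ I, F (Function.update p k t) ≤ A p / 2 ^ n k := by
      apply Finset.exists_le_of_sum_le hne
      rw [Finset.sum_const, hcI]
      simp only [nsmul_eq_mul]
      push_cast
      rw [mul_div_cancel₀ _ (by positivity)]
    obtain ⟨c, hc, hP⟩ := hF (Function.update p k t) (by
      rw [hB, Fintype.mem_piFinset]
      intro j
      by_cases hj : j = k
      · subst hj; simpa using ht
      · simpa [hj] using hp' j)
    have hpk := hp' k
    simp only [Function.update_self, hI', Finset.mem_Ico] at hpk
    simp only [hI, hs, Finset.mem_Ico] at ht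
    have h2 := hP.extend (p k) (by omega)
    rw [Function.update_eq_self] at h2
    refine ⟨_, add_le_add (hc.trans hFt) ?_, h2⟩
    apply Finset.sum_le_sum_of_subset_of_nonneg
    · intro u hu
      simp only [hW, Finset.mem_Ico] at hu ⊢
      omega
    · intro u _ _
      exact Real.rpow_nonneg (hℓ _) _
  · rw [hB', hB, sum_piFinset_eq_sum_update s k I', sum_piFinset_eq_sum_update s k I, ← hT]
    have hcost : ∑ q ∈ T, D q ≤ (3 + ∑' p, ℓ p) * (2 ^ (∑ j, n j) : ℝ) ^ (1 - τ k) := by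
      simp only [hD]
      rw [hT, ← sum_piFinset_eq_sum_update s k W fun p => ℓ p ^ τ k]
      set X : ℝ := 2 ^ (∑ j, n j) with hX
      have hX0 : 0 < X := by positivity
      have hcard : ((Fintype.piFinset (Function.update s k W)).card : ℝ) = 3 * X := by
        rw [hX, Finset.card_eq_sum_ones, sum_piFinset_eq_sum_update, ← hT]
        have : ∑ q ∈ T, ∑ t ∈ W, 1 = 3 * 2 ^ ∑ j, n j := by
          simp only [Finset.sum_const, hcW, smul_eq_mul, ← hcT]; ring
        rw [this]; push_cast; rfl
      calc ∑ p ∈ Fintype.piFinset (Function.update s k W), ℓ p ^ τ k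
          ≤ ∑ p ∈ Fintype.piFinset (Function.update s k W),
              (X⁻¹ ^ τ k + X⁻¹ ^ (τ k - 1) * ℓ p) :=
            Finset.sum_le_sum fun p _ =>
              rpow_le_rpow_add_rpow_mul (hℓ p) (by positivity) hτ hτ1
        _ = 3 * X * X⁻¹ ^ τ k + X⁻¹ ^ (τ k - 1) *
              ∑ p ∈ Fintype.piFinset (Function.update s k W), ℓ p := by
            rw [Finset.sum_add_distrib, Finset.sum_const, nsmul_eq_mul, hcard, Finset.mul_sum]
        _ ≤ 3 * X * X⁻¹ ^ τ k + X⁻¹ ^ (τ k - 1) * ∑' p, ℓ p := by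
            gcongr
            exact hsum.sum_le_tsum _ fun p _ => hℓ p
        _ = (3 + ∑' p, ℓ p) * X ^ (1 - τ k) := by
            have e1 : X⁻¹ ^ (τ k - 1) = X ^ (1 - τ k) := by
              rw [Real.inv_rpow hX0.le, ← Real.rpow_neg hX0.le, neg_sub]
            have e2 : X * X⁻¹ ^ τ k = X ^ (1 - τ k) := by
              rw [Real.inv_rpow hX0.le, Real.rpow_sub hX0, Real.rpow_one, div_eq_mul_inv]
            rw [e1, mul_assoc, e2]; ring
    have hin : ∀ q ∈ T, ∑ t ∈ I', (A (Function.update q k t) / 2 ^ n k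
        + D (Function.update q k t)) = 2 * A q + 2 ^ (n k + 1) * D q := by
      intro q _
      simp only [hA, hD, Function.update_idem, Finset.sum_const, hcI', nsmul_eq_mul]
      push_cast
      field_simp
      ring
    rw [Finset.sum_congr rfl hin, Finset.sum_add_distrib, ← Finset.mul_sum, ← Finset.mul_sum]
    gcongr

theorem exists_pathCost_le {ι : Type*} [Fintype ι] [DecidableEq ι]
    {ℓ : (ι → ℕ) → ℝ} {τ : ι → ℝ} (hℓ : ∀ p, 0 ≤ ℓ p) (hsum : Summable ℓ)
    (hτ : ∀ k, 0 < τ k) (hτ1 : ∀ k, τ k ≤ 1) (hτsum : 1 < ∑ k, τ k) :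
    ∃ S : ℝ, ∀ N : ℕ, ∃ (p : ι → ℕ) (c : ℝ), PathCost ℓ τ p c ∧ c ≤ S ∧ N ≤ ∑ k, p k := by
  set Θ := ∑ k, τ k with hΘ
  have hne : (Finset.univ : Finset ι).Nonempty := by
    by_contra h
    rw [Finset.not_nonempty_iff_eq_empty] at h
    rw [hΘ, h, Finset.sum_empty] at hτsum
    linarith
  obtain ⟨k₀, -, hk₀⟩ := Finset.exists_min_image Finset.univ τ hne
  set ε := τ k₀ - τ k₀ / Θ with hε
  have hΘ0 : 0 < Θ := by linarith
  have hε0 : 0 < ε := by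
    rw [hε, sub_pos, div_lt_iff₀ hΘ0]
    nlinarith [hτ k₀]
  have hεk : ∀ k, τ k / Θ - τ k ≤ -ε := by
    intro k
    have h1 := hk₀ k (Finset.mem_univ k)
    have h2 : 0 ≤ 1 - 1 / Θ := by
      rw [sub_nonneg, div_le_one hΘ0]; exact hτsum.le
    have h3 := mul_le_mul_of_nonneg_right h1 h2
    rw [hε]
    have e1 : τ k₀ * (1 - 1 / Θ) = τ k₀ - τ k₀ / Θ := by ring
    have e2 : τ k * (1 - 1 / Θ) = τ k - τ k / Θ := by ring
    linarith
  set r : ℝ := 2 ^ (-ε) with hr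
  have hr0 : 0 < r := by positivity
  have hr1 : r < 1 := Real.rpow_lt_one_of_one_lt_of_neg (by norm_num) (by linarith)
  set C : ℝ := 3 + ∑' p, ℓ p with hC
  have hC0 : 0 ≤ C := by have : 0 ≤ ∑' p, ℓ p := tsum_nonneg hℓ; positivity
  have key : ∀ s : ℕ, ∃ n : ι → ℕ, ∑ j, n j = s ∧ ∃ F : (ι → ℕ) → ℝ,
      (∀ p ∈ dyadicBox n, ∃ c ≤ F p, PathCost ℓ τ p c) ∧
      ∑ p ∈ dyadicBox n, F p ≤ 2 ^ s * (C * ∑ i ∈ Finset.range s, r ^ i) := by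
    intro s
    induction s with
    | zero =>
      refine ⟨0, by simp, fun _ => 0, fun p hp => ⟨0, le_rfl, ?_⟩, by simp⟩
      have : p = 0 := by
        rw [dyadicBox, Fintype.mem_piFinset] at hp
        ext j
        simpa using hp j
      rw [this]
      exact PathCost.zero
    | succ s ih =>
      obtain ⟨n, hn, F, hF, hFs⟩ := ih
      obtain ⟨k, -, hk⟩ : ∃ k ∈ Finset.univ, (n k : ℝ) ≤ τ k / Θ * s := by
        apply Finset.exists_le_of_sum_le hne
        rw [← Finset.sum_mul, ← Finset.sum_div, ← hΘ, div_self hΘ0.ne', one_mul]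
        exact_mod_cast hn.le
      obtain ⟨F', hF', hFs'⟩ :=
        exists_pathCost_dyadicBox_succ hℓ hsum n k (hτ k).le (hτ1 k) F hF
      refine ⟨n + Pi.single k 1, by simp [Finset.sum_add_distrib, hn], F', hF', hFs'.trans ?_⟩
      rw [hn, Finset.sum_range_succ]
      have hb : (2 : ℝ) ^ (n k + 1) * (2 ^ s : ℝ) ^ (1 - τ k) ≤ 2 ^ (s + 1) * r ^ s := by
        rw [hr, ← Real.rpow_natCast 2 (n k + 1), ← Real.rpow_natCast 2 s,
          ← Real.rpow_natCast 2 (s + 1), ← Real.rpow_natCast _ s, ← Real.rpow_mul (by norm_num),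
          ← Real.rpow_mul (by norm_num), ← Real.rpow_add (by norm_num),
          ← Real.rpow_add (by norm_num)]
        apply Real.rpow_le_rpow_of_exponent_le (by norm_num)
        push_cast
        have := mul_le_mul_of_nonneg_right (hεk k) (Nat.cast_nonneg (α := ℝ) s)
        nlinarith
      have := mul_le_mul_of_nonneg_left hb hC0
      calc 2 * ∑ p ∈ dyadicBox n, F p + 2 ^ (n k + 1) * (C * (2 ^ s) ^ (1 - τ k))
          ≤ 2 * (2 ^ s * (C * ∑ i ∈ Finset.range s, r ^ i)) + C * (2 ^ (s + 1) * r ^ s) := by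
            rw [mul_left_comm]; gcongr
        _ = 2 ^ (s + 1) * (C * (∑ i ∈ Finset.range s, r ^ i + r ^ s)) := by ring
  refine ⟨C * (1 - r)⁻¹, fun N => ?_⟩
  obtain ⟨n, hn, F, hF, hFs⟩ := key N
  have hcard := card_dyadicBox n
  obtain ⟨p, hp, hFp⟩ : ∃ p ∈ dyadicBox n, F p ≤ C * (1 - r)⁻¹ := by
    apply Finset.exists_le_of_sum_le (Finset.card_pos.1 (by rw [hcard]; positivity))
    rw [Finset.sum_const, hcard, hn, nsmul_eq_mul]
    push_cast
    refine hFs.trans ?_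
    gcongr
    rw [← tsum_geometric_of_lt_one hr0.le hr1]
    exact (summable_geometric_of_lt_one hr0.le hr1).sum_le_tsum _ fun i _ => by positivity
  obtain ⟨c, hc, hP⟩ := hF p hp
  refine ⟨p, c, hP, hc.trans hFp, ?_⟩
  rw [← hn]
  refine Finset.sum_le_sum fun j _ => ?_
  rw [dyadicBox, Fintype.mem_piFinset] at hp
  have h1 := (Finset.mem_Ico.1 (hp j)).1
  have h2 := Nat.lt_two_pow_self (n := n j)
  omega

theorem exists_nat_forall_exists_add_mem_Ioo {a : ℝ} (ha : Irrational a) {u v : ℝ} (huv : u < v) :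
    ∃ N : ℕ, ∀ θ : ℝ, ∃ n ≤ N, ∃ m : ℤ, θ + n * a - m ∈ Ioo u v := by
  have hdense : DenseRange (fun n : ℕ => n • (a : AddCircle (1 : ℝ))) :=
    denseRange_zsmul_iff_nsmul.1 (AddCircle.denseRange_zsmul_coe_iff.2 (by simpa using ha))
  have hcover : ∀ θ : ℝ, ∃ (n : ℕ) (m : ℤ), θ + n * a - m ∈ Ioo u v := by
    intro θ
    have hopen : IsOpen ((fun x : ℝ => (x : AddCircle (1 : ℝ))) '' Ioo (u - θ) (v - θ)) :=
      QuotientAddGroup.isOpenMap_coe _ isOpen_Ioo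
    obtain ⟨n, y, hy, hyn⟩ := hdense.exists_mem_open hopen
      ((nonempty_Ioo.2 (by linarith)).image _)
    have h0 : ((y - n * a : ℝ) : AddCircle (1 : ℝ)) = 0 := by
      simp only [AddCircle.coe_sub, sub_eq_zero]
      rw [← nsmul_eq_mul]
      exact hyn
    obtain ⟨m, hm⟩ := (AddCircle.coe_eq_zero_iff (1 : ℝ)).1 h0
    refine ⟨n, -m, ?_⟩
    simp only [zsmul_eq_mul, mul_one] at hm
    rw [mem_Ioo] at hy ⊢
    push_cast
    constructor <;> linarith [hy.1, hy.2]
  let U : ℕ → Set ℝ := fun n => ⋃ m : ℤ, (fun θ : ℝ => θ + n * a - m) ⁻¹' Ioo u v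
  have hU : ∀ n, IsOpen (U n) := fun n =>
    isOpen_iUnion fun m => isOpen_Ioo.preimage (by fun_prop)
  obtain ⟨t, ht⟩ := (isCompact_Icc (a := (0 : ℝ)) (b := 1)).elim_finite_subcover U hU fun θ _ => by
    obtain ⟨n, m, h⟩ := hcover θ
    exact mem_iUnion.2 ⟨n, mem_iUnion.2 ⟨m, h⟩⟩
  refine ⟨t.sup id, fun θ => ?_⟩
  have hθ := ht (show Int.fract θ ∈ Icc (0 : ℝ) 1 from
    ⟨Int.fract_nonneg _, (Int.fract_lt_one _).le⟩)
  simp only [mem_iUnion, U, mem_preimage] at hθ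
  obtain ⟨n, hn, m, h⟩ := hθ
  refine ⟨n, Finset.le_sup (f := id) hn, m + ⌊θ⌋, ?_⟩
  convert h using 1
  rw [Int.fract]
  push_cast
  ring

theorem CircleDeg1Lift.exists_semiconj_add_translationNumber {ι : Type*} [Fintype ι]
    (F : ι → CircleDeg1Lift) (hF : ∀ i, Function.Bijective (F i))
    (hcomm : ∀ i j, Commute (F i) (F j)) :
    ∃ h : CircleDeg1Lift, ∀ i x, h (F i x) = h x + (F i).translationNumber := by
  classical
  choose g hg using fun i => CircleDeg1Lift.isUnit_iff_bijective.2 (hF i)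
  have hgc : ∀ i j, Commute (g i) (g j) := fun i j => by
    have := hcomm i j
    rw [← hg, ← hg] at this
    exact Units.ext this
  have hgz : Pairwise fun i j => ∀ x y : Multiplicative ℤ,
      Commute (zpowersHom CircleDeg1Liftˣ (g i) x) (zpowersHom CircleDeg1Liftˣ (g j) y) :=
    fun i j _ x y => by
      simpa only [zpowersHom_apply] using (hgc i j).zpow_zpow _ _
  let f₁ : (ι → Multiplicative ℤ) →* CircleDeg1Lift := (Units.coeHom _).comp
    (MonoidHom.noncommPiCoprod (fun i => zpowersHom CircleDeg1Liftˣ (g i)) hgz)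
  have hf₁ : ∀ x y, Commute (f₁ x) (f₁ y) := fun x y => (Commute.all x y).map f₁
  let ρ : (ι → Multiplicative ℤ) →* Multiplicative ℝ :=
    { toFun := fun x => Multiplicative.ofAdd (f₁ x).translationNumber
      map_one' := by simp
      map_mul' := fun x y => by
        rw [map_mul, CircleDeg1Lift.translationNumber_mul_of_commute (hf₁ x y), ofAdd_add] }
  obtain ⟨h, hh⟩ := CircleDeg1Lift.semiconj_of_group_action_of_forall_translationNumber_eq f₁
    ((Units.coeHom _).comp (CircleDeg1Lift.translate.comp ρ)) fun x =>
      (CircleDeg1Lift.translationNumber_translate _).symm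
  refine ⟨h, fun i x => ?_⟩
  have hi : f₁ (Pi.mulSingle i (Multiplicative.ofAdd 1)) = F i := by
    rw [← hg i, MonoidHom.comp_apply, MonoidHom.noncommPiCoprod_mulSingle]
    simp
  have := hh (Pi.mulSingle i (Multiplicative.ofAdd 1)) x
  rw [hi] at this
  rw [this, add_comm, ← hi]
  exact CircleDeg1Lift.translate_apply _ _

theorem exists_pi_nat_action {ι M : Type*} [Fintype ι] [DecidableEq ι] [Monoid M] (F : ι → M)
    (hcomm : ∀ i j, Commute (F i) (F j)) :
    ∃ Φ : (ι → ℕ) → M, Φ 0 = 1 ∧ ∀ p k, Φ (p + Pi.single k 1) = F k * Φ p := by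
  have hpow : Pairwise fun i j => ∀ x y : Multiplicative ℕ,
      Commute (powersHom M (F i) x) (powersHom M (F j) y) :=
    fun i j _ x y => by
      simpa only [powersHom_apply] using (hcomm i j).pow_pow _ _
  let f := MonoidHom.noncommPiCoprod (fun i => powersHom M (F i)) hpow
  refine ⟨fun p => f fun k => Multiplicative.ofAdd (p k), f.map_one, fun p k => ?_⟩
  have h1 : (fun j => Multiplicative.ofAdd ((p + Pi.single k 1 : ι → ℕ) j)) =
      Pi.mulSingle k (Multiplicative.ofAdd 1) * fun j => Multiplicative.ofAdd (p j) := by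
    ext j
    by_cases hj : j = k
    · subst hj; simp [add_comm]
    · simp [hj]
  dsimp only
  rw [h1, map_mul]
  congr 1
  simp [f]

theorem IsCircleDiffeoLift.exists_deriv_bounds {f : ℝ → ℝ} (hf : IsCircleDiffeoLift f) :
    ∃ A B : ℝ, 0 < A ∧ 1 ≤ B ∧ ∀ x, A ≤ deriv f x ∧ deriv f x ≤ B := by
  obtain ⟨-, hper, hC1, hpos⟩ := hf
  have hp : Function.Periodic (deriv f) 1 := fun x => by
    rw [← deriv_comp_add_const f 1 x, funext hper, deriv_add_const]
  have hcont : ContinuousOn (deriv f) (Icc 0 1) := (hC1.continuous_deriv le_rfl).continuousOn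
  obtain ⟨u, -, hu⟩ := isCompact_Icc.exists_isMinOn (nonempty_Icc.2 zero_le_one) hcont
  obtain ⟨v, -, hv⟩ := isCompact_Icc.exists_isMaxOn (nonempty_Icc.2 zero_le_one) hcont
  refine ⟨deriv f u, max 1 (deriv f v), hpos u, le_max_left _ _, fun x => ?_⟩
  obtain ⟨y, hy, hxy⟩ := hp.exists_mem_Ico₀ one_pos x
  rw [hxy]
  exact ⟨hu (Ico_subset_Icc_self hy), (hv (Ico_subset_Icc_self hy)).trans (le_max_right _ _)⟩

theorem IsCircleDiffeoLift.exists_lipschitz_bound {f : ℝ → ℝ} (hf : IsCircleDiffeoLift f) :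
    ∃ B : ℝ, 1 ≤ B ∧ ∀ y z, y ≤ z → f z - f y ≤ B * (z - y) := by
  obtain ⟨A, B, -, hB, h⟩ := hf.exists_deriv_bounds
  exact ⟨B, hB, fun y z hyz => image_sub_le_mul_sub_of_deriv_le
    (hf.2.2.1.differentiable one_ne_zero) (fun x => (h x).2) hyz⟩

theorem IsCircleDiffeoLift.exists_distortion_bound {f : ℝ → ℝ} {τ : ℝ}
    (hf : IsCircleDiffeoLift f) (hτ : 0 < τ) (hreg : OmegaCont (fun t => t ^ τ) (deriv f)) :
    ∃ H : ℝ, 0 ≤ H ∧ ∀ R x y z : ℝ, 0 ≤ R → x ≤ y → y ≤ z → z ≤ x + 1 → z - y ≤ R * (y - x) →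
      f z - f y ≤ Real.exp (H * (z - x) ^ τ) * R * (f y - f x) := by
  obtain ⟨A, B, hA, -, hAB⟩ := hf.exists_deriv_bounds
  obtain ⟨K, hK⟩ := hreg
  refine ⟨|K| / A, by positivity, fun R x y z hR hxy hyz hzx hratio => ?_⟩
  have hmono : f x ≤ f y := hf.1.monotone hxy
  rcases hyz.eq_or_lt with rfl | hyz'
  · rw [sub_self]
    exact mul_nonneg (by positivity) (sub_nonneg.2 hmono)
  rcases hxy.eq_or_lt with rfl | hxy'
  · simp only [sub_self, mul_zero] at hratio
    linarith
  have hd : Differentiable ℝ f := hf.2.2.1.differentiable one_ne_zero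
  obtain ⟨ξ, hξ, hξ'⟩ := exists_deriv_eq_slope f hyz' hd.continuous.continuousOn hd.differentiableOn
  obtain ⟨η, hη, hη'⟩ := exists_deriv_eq_slope f hxy' hd.continuous.continuousOn hd.differentiableOn
  rw [eq_div_iff (sub_pos.2 hyz').ne'] at hξ'
  rw [eq_div_iff (sub_pos.2 hxy').ne'] at hη'
  have hdist : |ξ - η| ≤ z - x := by
    rw [abs_le]; constructor <;> linarith [hξ.1, hξ.2, hη.1, hη.2]
  have hpow : |ξ - η| ^ τ ≤ (z - x) ^ τ := Real.rpow_le_rpow (abs_nonneg _) hdist hτ.le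
  have h1 : deriv f ξ ≤ deriv f η + |K| * (z - x) ^ τ := by
    have h2 := (le_abs_self _).trans (hK ξ η (hdist.trans (by linarith)))
    have h3 : K * |ξ - η| ^ τ ≤ |K| * (z - x) ^ τ :=
      mul_le_mul (le_abs_self K) hpow (by positivity) (abs_nonneg K)
    linarith
  have h4 : deriv f ξ ≤ Real.exp (|K| / A * (z - x) ^ τ) * deriv f η := by
    have h5 := Real.add_one_le_exp (|K| / A * (z - x) ^ τ)
    have h6 : |K| * (z - x) ^ τ ≤ |K| / A * (z - x) ^ τ * deriv f η := by
      rw [div_mul_eq_mul_div, div_mul_eq_mul_div, le_div_iff₀ hA]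
      exact mul_le_mul_of_nonneg_left (hAB η).1
        (mul_nonneg (abs_nonneg K) (Real.rpow_nonneg (by linarith) _))
    nlinarith [hAB η]
  rw [← hξ', ← hη']
  calc deriv f ξ * (z - y)
      ≤ Real.exp (|K| / A * (z - x) ^ τ) * deriv f η * (R * (y - x)) :=
        mul_le_mul h4 hratio (by linarith) (mul_nonneg (Real.exp_pos _).le (hf.2.2.2 η).le)
    _ = _ := by ring

theorem CircleDeg1Lift.summable_sub_of_injective_mod_one (h : CircleDeg1Lift) {κ : Type*}
    (x y : κ → ℝ) (hxy : ∀ p, x p ≤ y p) (hconst : ∀ p, h (x p) = h (y p))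
    (hinj : ∀ p q (m : ℤ), h (x p) = h (x q) + m → p = q) :
    Summable fun p => y p - x p := by
  let J : κ → Set ℝ := fun p => Icc (x p - ⌊h (x p)⌋) (y p - ⌊h (x p)⌋)
  have hJ : ∀ p, ∀ z ∈ J p, h z = Int.fract (h (x p)) := by
    intro p z hz
    have h1 := h.monotone hz.1
    have h2 := h.monotone hz.2
    rw [h.map_sub_int] at h1 h2
    rw [← hconst p] at h2
    exact le_antisymm h2 h1
  have hdisj : ∀ p q, p ≠ q → Disjoint (J p) (J q) := by
    intro p q hpq
    rw [Set.disjoint_left]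
    intro z hp hq
    apply hpq
    have := (hJ p z hp).symm.trans (hJ q z hq)
    apply hinj p q (⌊h (x p)⌋ - ⌊h (x q)⌋)
    simp only [Int.fract] at this
    push_cast
    linarith
  set n := ⌊h 0⌋ with hn
  have hsub : ∀ p, J p ⊆ Icc (-1 - n : ℝ) (1 - n) := by
    intro p z hz
    have h0 := Int.fract_nonneg (h (x p))
    have h1 := Int.fract_lt_one (h (x p))
    rw [← hJ p z hz] at h0 h1
    have hl : h (-1 - n : ℝ) = h 0 - 1 - n := by
      have := h.map_sub_int 0 (1 + n)
      push_cast at this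
      rw [show (-1 - n : ℝ) = 0 - (1 + n) by ring, this]; ring
    have hr : h (1 - n : ℝ) = h 0 + 1 - n := by
      have := h.map_sub_int 0 (n - 1)
      push_cast at this
      rw [show (1 - n : ℝ) = 0 - (n - 1) by ring, this]; ring
    have hn1 := Int.floor_le (h 0)
    have hn2 := Int.lt_floor_add_one (h 0)
    constructor
    · by_contra! hlt
      have := h.monotone hlt.le
      rw [hl] at this
      linarith
    · by_contra! hlt
      have := h.monotone hlt.le
      rw [hr] at this
      linarith
  refine summable_of_sum_le (c := 2) (fun p => sub_nonneg.2 (hxy p)) fun s => ?_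
  have hvol : ∀ p, MeasureTheory.volume (J p) = ENNReal.ofReal (y p - x p) := by
    intro p
    rw [Real.volume_Icc]
    congr 1
    ring
  have hunion : MeasureTheory.volume (⋃ p ∈ s, J p) = ∑ p ∈ s, MeasureTheory.volume (J p) :=
    MeasureTheory.measure_biUnion_finset (fun p _ q _ hpq => hdisj p q hpq)
      fun p _ => measurableSet_Icc
  have hle : MeasureTheory.volume (⋃ p ∈ s, J p) ≤ ENNReal.ofReal 2 := by
    refine (MeasureTheory.measure_mono (iUnion₂_subset fun p _ => hsub p)).trans ?_
    rw [Real.volume_Icc]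
    apply ENNReal.ofReal_le_ofReal
    linarith
  rw [hunion, Finset.sum_congr rfl fun p _ => hvol p,
    ← ENNReal.ofReal_sum_of_nonneg fun p _ => sub_nonneg.2 (hxy p)] at hle
  exact (ENNReal.ofReal_le_ofReal_iff (by norm_num)).1 hle

theorem CircleDeg1Lift.continuous_of_semiconj_add_irrational {h F : CircleDeg1Lift} {a : ℝ}
    (ha : Irrational a) (hF : ∀ x, h (F x) = h x + a) : Continuous h := by
  have hit : ∀ (n : ℕ) (x : ℝ), h (F^[n] x) = h x + n * a := by
    intro n
    induction n with
    | zero => simp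
    | succ n ih =>
      intro x
      rw [Function.iterate_succ_apply', hF, ih]
      push_cast
      ring
  refine h.monotone.continuous_of_denseRange (dense_of_exists_between fun u v huv => ?_)
  obtain ⟨N, hN⟩ := exists_nat_forall_exists_add_mem_Ioo ha huv
  obtain ⟨n, -, m, hm⟩ := hN (h 0)
  refine ⟨_, mem_range_self (F^[n] 0 - m), ?_⟩
  rw [h.map_sub_int, hit]
  exact hm

theorem rational_combination_injective {d : ℕ} {α : Fin d → ℝ} (hindep : RatIndep α)
    {p q : Fin d → ℕ} {m : ℤ} (h : ∑ k, (p k : ℝ) * α k = ∑ k, (q k : ℝ) * α k + m) : p = q := by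
  have := hindep (fun k => (p k : ℚ) - q k) (-m) (by
    push_cast
    simp only [sub_mul, Finset.sum_sub_distrib]
    linarith)
  ext k
  have hk := this.2 k
  rw [sub_eq_zero] at hk
  exact_mod_cast hk

theorem RatIndep.irrational {d : ℕ} {α : Fin d → ℝ} (hindep : RatIndep α) (k : Fin d) :
    Irrational (α k) := by
  rintro ⟨r, hr⟩
  have := hindep (Pi.single k 1) (-r) (by
    rw [Finset.sum_eq_single k]
    · simp [hr]
    · intro j _ hj; simp [hj]
    · simp)
  simpa using this.2 k

theorem apply_pi_nat_action {ι : Type*} [Fintype ι] [DecidableEq ι] {F : ι → CircleDeg1Lift}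
    {Φ : (ι → ℕ) → CircleDeg1Lift} (h0 : Φ 0 = 1) (hΦ : ∀ p k, Φ (p + Pi.single k 1) = F k * Φ p)
    {h : CircleDeg1Lift} {α : ι → ℝ} (hF : ∀ k x, h (F k x) = h x + α k) (p : ι → ℕ) (x : ℝ) :
    h (Φ p x) = h x + ∑ k, (p k : ℝ) * α k := by
  induction hn : ∑ k, p k generalizing p with
  | zero =>
    have : p = 0 := by
      ext k
      exact Finset.sum_eq_zero_iff.1 hn k (Finset.mem_univ k)
    simp [this, h0]
  | succ n ih =>
    obtain ⟨k, -, hk⟩ := Finset.exists_ne_zero_of_sum_ne_zero (by rw [hn]; omega)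
    obtain ⟨q, rfl⟩ : ∃ q : ι → ℕ, p = q + Pi.single k 1 := by
      refine ⟨p - (Pi.single k 1 : ι → ℕ), ?_⟩
      ext j
      by_cases hj : j = k
      · subst hj
        simp only [Pi.add_apply, Pi.sub_apply, Pi.single_eq_same]
        omega
      · simp [hj]
    have hq : ∑ k, q k = n := by
      simpa [Finset.sum_add_distrib] using hn
    rw [hΦ, CircleDeg1Lift.mul_apply, hF, ih q hq]
    simp [Finset.sum_add_distrib, add_mul, Pi.single_apply, add_assoc]

theorem PathCost.sub_le_sub {ι : Type*} [DecidableEq ι] {F : ι → CircleDeg1Lift}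
    {Φ : (ι → ℕ) → CircleDeg1Lift} (h0 : Φ 0 = 1) (hΦ : ∀ p k, Φ (p + Pi.single k 1) = F k * Φ p)
    {τ : ι → ℝ} (hτ : ∀ k, 0 < τ k) (hτ1 : ∀ k, τ k ≤ 1) {H : ℝ} (hH : 0 ≤ H)
    (hdist : ∀ k, ∀ R x y z : ℝ, 0 ≤ R → x ≤ y → y ≤ z → z ≤ x + 1 → z - y ≤ R * (y - x) →
      F k z - F k y ≤ Real.exp (H * (z - x) ^ τ k) * R * (F k y - F k x))
    {a b b' S : ℝ} (hab : a ≤ b) (hbb' : b ≤ b') (hb'a : b' ≤ a + 1)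
    (hsmall : b' - b ≤ Real.exp (-(2 * H * S)) * (b - a))
    {p : ι → ℕ} {c : ℝ} (hp : PathCost (fun p => Φ p b - Φ p a) τ p c) (hc : c ≤ S) :
    Φ p b' - Φ p b ≤ Φ p b - Φ p a := by
  have hnn : ∀ p, 0 ≤ Φ p b - Φ p a := fun p => sub_nonneg.2 ((Φ p).monotone hab)
  have hle : ∀ {p : ι → ℕ} {c : ℝ}, c ≤ S →
      Φ p b' - Φ p b ≤ Real.exp (2 * H * (c - S)) * (Φ p b - Φ p a) →
      Φ p b' - Φ p b ≤ Φ p b - Φ p a := by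
    intro p c hc h
    refine h.trans (mul_le_of_le_one_left (hnn p) (Real.exp_le_one_iff.2 ?_))
    exact mul_nonpos_of_nonneg_of_nonpos (by positivity) (by linarith)
  refine hle hc ?_
  induction hp with
  | zero =>
    simpa [h0] using hsmall
  | @step p c k hp ih =>
    have hpow : 0 ≤ (Φ p b - Φ p a) ^ τ k := Real.rpow_nonneg (hnn p) _
    have hcS : c ≤ S := by linarith
    have ih := ih hcS
    have hm := hle hcS ih
    have hlen : Φ p b' - Φ p a ≤ 2 * (Φ p b - Φ p a) := by linarith
    have h2 : (Φ p b' - Φ p a) ^ τ k ≤ 2 * (Φ p b - Φ p a) ^ τ k := by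
      have hΦab' := (Φ p).monotone (hab.trans hbb')
      refine (Real.rpow_le_rpow (sub_nonneg.2 hΦab') hlen (hτ k).le).trans ?_
      rw [Real.mul_rpow (by norm_num) (hnn p)]
      refine mul_le_mul_of_nonneg_right ?_ hpow
      simpa using Real.rpow_le_rpow_of_exponent_le one_le_two (hτ1 k)
    have hone : Φ p b' ≤ Φ p a + 1 := by
      rw [← (Φ p).map_add_one]
      exact (Φ p).monotone hb'a
    have hstep := hdist k _ _ _ _ (Real.exp_pos (2 * H * (c - S))).le ((Φ p).monotone hab)
      ((Φ p).monotone hbb') hone ih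
    simp only [hΦ, CircleDeg1Lift.mul_apply]
    refine hstep.trans (mul_le_mul_of_nonneg_right ?_
      (sub_nonneg.2 ((F k).monotone ((Φ p).monotone hab))))
    rw [← Real.exp_add, Real.exp_le_exp]
    nlinarith [mul_le_mul_of_nonneg_left h2 hH]

theorem CircleDeg1Lift.injective_of_semiconj_add {d : ℕ} [NeZero d] {τ : Fin d → ℝ}
    (hτ : ∀ k, τ k ∈ Ioo (0 : ℝ) 1) (hτsum : 1 < ∑ k, τ k) (F : Fin d → CircleDeg1Lift)
    (hdiff : ∀ k, IsCircleDiffeoLift (F k))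
    (hreg : ∀ k, OmegaCont (fun t => t ^ τ k) (deriv (F k)))
    (hcomm : ∀ i j, Commute (F i) (F j)) {α : Fin d → ℝ} (hindep : RatIndep α)
    {h : CircleDeg1Lift} (hcont : Continuous h) (hF : ∀ k x, h (F k x) = h x + α k) :
    Function.Injective h := by
  by_contra hinj
  obtain ⟨a, y₀, hay₀, hya⟩ : ∃ a y, a < y ∧ h y = h a := by
    simp only [Function.Injective, not_forall] at hinj
    obtain ⟨x, y, hxy, hne⟩ := hinj
    rcases lt_or_gt_of_ne hne with hlt | hlt
    · exact ⟨x, y, hlt, hxy.symm⟩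
    · exact ⟨y, x, hlt, hxy⟩
  obtain ⟨b, hb⟩ : ∃ b, IsGreatest {z | h z = h a} b := by
    have hbdd : BddAbove {z | h z = h a} := ⟨a + 1, fun z hz => by
      by_contra! hlt
      have := h.monotone hlt.le
      rw [h.map_add_one, show h z = h a from hz] at this
      linarith⟩
    exact ⟨_, (isClosed_eq hcont continuous_const).isGreatest_csSup ⟨a, rfl⟩ hbdd⟩
  have hab : a < b := hay₀.trans_le (hb.2 hya)
  have hhb : h b = h a := hb.1
  have hgt : ∀ z, b < z → h b < h z := fun z hz =>
    (h.monotone hz.le).lt_of_ne fun heq => (hb.2 (heq.symm.trans hhb)).not_gt hz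
  have hba1 : b < a + 1 := by
    by_contra! hle
    have := h.monotone hle
    rw [h.map_add_one, hhb] at this
    linarith
  obtain ⟨Φ, h0, hΦ⟩ := exists_pi_nat_action F hcomm
  have hΦh := apply_pi_nat_action h0 hΦ hF
  have hsum : Summable fun p => Φ p b - Φ p a := by
    refine h.summable_sub_of_injective_mod_one (fun p => Φ p a) (fun p => Φ p b)
      (fun p => (Φ p).monotone hab.le) (fun p => ?_) fun p q m hpq => ?_
    · rw [hΦh, hΦh, hhb]
    · rw [hΦh, hΦh] at hpq
      exact rational_combination_injective hindep (m := m) (by linarith)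
  have hnn : ∀ p, 0 ≤ Φ p b - Φ p a := fun p => sub_nonneg.2 ((Φ p).monotone hab.le)
  obtain ⟨S, hS⟩ := exists_pathCost_le hnn hsum (fun k => (hτ k).1) (fun k => (hτ k).2.le) hτsum
  choose Hk hHk0 hHk using fun k => (hdiff k).exists_distortion_bound (hτ k).1 (hreg k)
  set H := ∑ k, Hk k with hH
  have hH0 : 0 ≤ H := Finset.sum_nonneg fun k _ => hHk0 k
  have hdist : ∀ k, ∀ R x y z : ℝ, 0 ≤ R → x ≤ y → y ≤ z → z ≤ x + 1 → z - y ≤ R * (y - x) →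
      F k z - F k y ≤ Real.exp (H * (z - x) ^ τ k) * R * (F k y - F k x) := by
    intro k R x y z hR hxy hyz hzx hratio
    refine (hHk k R x y z hR hxy hyz hzx hratio).trans ?_
    have hFxy : 0 ≤ F k y - F k x := sub_nonneg.2 ((F k).monotone hxy)
    have hzx0 : 0 ≤ z - x := by linarith
    have hle : Hk k ≤ H := Finset.single_le_sum (fun j _ => hHk0 j) (Finset.mem_univ k)
    gcongr
  set δ := min (Real.exp (-(2 * H * S)) * (b - a)) (a + 1 - b) with hδ
  have hδ0 : 0 < δ := lt_min (mul_pos (Real.exp_pos _) (sub_pos.2 hab)) (by linarith)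
  have hδ1 : δ ≤ Real.exp (-(2 * H * S)) * (b - a) := min_le_left _ _
  have hδ2 : δ ≤ a + 1 - b := min_le_right _ _
  obtain ⟨N, hN⟩ := exists_nat_forall_exists_add_mem_Ioo (hindep.irrational 0)
    (hgt (b + δ / 2) (by linarith))
  obtain ⟨M, hM1, hM⟩ := (hdiff 0).exists_lipschitz_bound
  have hMit : ∀ (n : ℕ) (y z : ℝ), y ≤ z → (F 0)^[n] z - (F 0)^[n] y ≤ M ^ n * (z - y) := by
    intro n
    induction n with
    | zero => simp
    | succ n ih =>
      intro y z hyz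
      rw [Function.iterate_succ_apply, Function.iterate_succ_apply, pow_succ, mul_assoc]
      refine (ih _ _ ((F 0).monotone hyz)).trans ?_
      gcongr
      exact hM y z hyz
  have hhit : ∀ (n : ℕ) (x : ℝ), h ((F 0)^[n] x) = h x + n * α 0 := by
    intro n
    induction n with
    | zero => simp
    | succ n ih =>
      intro x
      rw [Function.iterate_succ_apply', hF, ih]
      push_cast
      ring
  have hMN : 0 < M ^ N := by positivity
  obtain ⟨p, c, hp, hc, hlp⟩ : ∃ p c, PathCost (fun p => Φ p b - Φ p a) τ p c ∧ c ≤ S ∧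
      Φ p b - Φ p a ≤ δ / 2 / M ^ N := by
    have hev := hsum.tendsto_cofinite_zero.eventually_le_const
      (show 0 < δ / 2 / M ^ N by positivity)
    rw [eventually_cofinite] at hev
    obtain ⟨p, c, hp, hc, hpN⟩ := hS (hev.toFinset.sup (fun p => ∑ k, p k) + 1)
    refine ⟨p, c, hp, hc, ?_⟩
    by_contra hcon
    have := Finset.le_sup (f := fun p : Fin d → ℕ => ∑ k, p k)
      (hev.mem_toFinset.2 (show p ∈ {p | ¬ Φ p b - Φ p a ≤ δ / 2 / M ^ N} from hcon))
    omega
  have hm := hp.sub_le_sub h0 hΦ (fun k => (hτ k).1) (fun k => (hτ k).2.le) hH0 hdist hab.le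
    (show b ≤ b + δ by linarith) (by linarith) (by linarith) hc
  obtain ⟨n, hn, m, hnm⟩ := hN (h (Φ p b))
  have hlow : (F 0)^[n] (Φ p b) - m < b + δ / 2 := by
    by_contra! hle
    have := h.monotone hle
    rw [h.map_sub_int, hhit] at this
    exact this.not_gt hnm.2
  have hlen : (F 0)^[n] (Φ p (b + δ)) - (F 0)^[n] (Φ p b) ≤ δ / 2 := by
    have hΦb := (Φ p).monotone (show b ≤ b + δ by linarith)
    calc _ ≤ M ^ n * (Φ p (b + δ) - Φ p b) := hMit n _ _ hΦb
      _ ≤ M ^ N * (δ / 2 / M ^ N) :=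
        mul_le_mul (pow_le_pow_right₀ hM1 hn) (hm.trans hlp) (sub_nonneg.2 hΦb) hMN.le
      _ = δ / 2 := mul_div_cancel₀ _ hMN.ne'
  have hcontr := h.monotone (show (F 0)^[n] (Φ p (b + δ)) - m ≤ b + δ by linarith)
  rw [h.map_sub_int, hhit, hΦh] at hcontr
  have hlt := hnm.1
  rw [hΦh] at hlt
  linarith

/-- Theorem (Kleptsyn–Navas): commuting `C^{1+τ_k}` circle diffeomorphisms with
`τ₁ + ⋯ + τ_d > 1` and rotation numbers independent over the rationals are
simultaneously topologically conjugate to rotations. -/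
theorem commuting_holder_diffeos_conjugate_to_rotations
    {d : ℕ} (hd : 2 ≤ d) (τ : Fin d → ℝ)
    (hτ : ∀ k, τ k ∈ Ioo (0 : ℝ) 1) (hτsum : 1 < ∑ k, τ k)
    (f : Fin d → ℝ → ℝ)
    (hdiff : ∀ k, IsCircleDiffeoLift (f k))
    (hreg : ∀ k, OmegaCont (fun t => t ^ τ k) (deriv (f k)))
    (hcomm : ∀ i j, ∀ x, f i (f j x) = f j (f i x))
    (α : Fin d → ℝ) (hα : ∀ k, HasRotationNumber (f k) (α k))
    (hindep : RatIndep α) :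
    SimultaneouslyConjToRotations f := by
  have : NeZero d := ⟨by omega⟩
  have hcont : ∀ k, Continuous (f k) := fun k => (hdiff k).2.2.1.continuous
  let F : Fin d → CircleDeg1Lift := fun k => ⟨⟨f k, (hdiff k).1.monotone⟩, (hdiff k).2.1⟩
  have hbij : ∀ k, Function.Bijective (F k) := fun k =>
    ⟨(hdiff k).1.injective, (F k).continuous_iff_surjective.1 (hcont k)⟩
  have hFcomm : ∀ i j, Commute (F i) (F j) := fun i j => CircleDeg1Lift.ext fun x => hcomm i j x
  have htrans : ∀ k, (F k).translationNumber = α k := fun k =>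
    (F k).translationNumber_eq_of_tendsto₀ (hα k)
  obtain ⟨h, hh⟩ := CircleDeg1Lift.exists_semiconj_add_translationNumber F hbij hFcomm
  simp only [htrans] at hh
  have hhc : Continuous h :=
    CircleDeg1Lift.continuous_of_semiconj_add_irrational (hindep.irrational 0) (hh 0)
  have hinj : Function.Injective h :=
    CircleDeg1Lift.injective_of_semiconj_add hτ hτsum F hdiff hreg hFcomm hindep hhc hh
  exact ⟨h, ⟨hhc, h.strictMono_iff_injective.2 hinj, h.map_add_one⟩, fun k => ⟨α k, hh k⟩⟩
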